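/- Let X be a finitely generated module over the Iwasawa algebra Λ = ℤ_ℓ[[X]] and let T be its largest finite Λ-submodule (T is finite and contains every finite Λ-submodule of X). Then there exists N ∈ ℕ such that for all n ≥ N one has T ∩ ω_n X = 0; consequently, for n ≥ N the natural map T → (T + ω_n X)/ω_n X is an isomorphism, so the capitulation kernels (T + ω_n X)/ω_n X ⊆ X/ω_n X are ultimately all isomorphic to T. -/

import Mathlib

open PowerSeries in
/-- `ω_n = (1+X)^(ℓ^n) - 1` in the Iwasawa algebra `Λ = ℤ_ℓ[[X]]`. -/
noncomputable def omegaIw (ℓ : ℕ) [Fact ℓ.Prime] (n : ℕ) : PowerSeries ℤ_[ℓ] :=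
  (1 + PowerSeries.X) ^ ℓ ^ n - 1

/-- The submodule `ω_n X` of a `Λ`-module `X`. -/
noncomputable def omegaSub (ℓ : ℕ) [Fact ℓ.Prime] (n : ℕ)
    (X : Type*) [AddCommGroup X] [Module (PowerSeries ℤ_[ℓ]) X] :
    Submodule (PowerSeries ℤ_[ℓ]) X :=
  LinearMap.range (LinearMap.lsmul (PowerSeries ℤ_[ℓ]) X (omegaIw ℓ n))

open IsLocalRing in
theorem exists_maximalIdeal_pow_le_annihilator_of_finite {R M : Type*} [CommRing R]
    [IsLocalRing R] [AddCommGroup M] [Module R M] [Finite M] :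
    ∃ k, maximalIdeal R ^ k ≤ Module.annihilator R M := by
  have h : Finite (R ⧸ RingHom.ker (Module.toAddMonoidEnd R M)) :=
    Finite.of_injective (fun r ↦ (RingHom.kerLift (Module.toAddMonoidEnd R M) r : M → M))
      (DFunLike.coe_injective.comp (RingHom.kerLift_injective _))
  exact exists_maximalIdeal_pow_le_of_isArtinianRing_quotient
    (RingHom.ker (Module.toAddMonoidEnd R M))

theorem omegaIw_succ_eq_mul (ℓ : ℕ) [Fact ℓ.Prime] (n : ℕ) :
    ∃ ν ∈ IsLocalRing.maximalIdeal (PowerSeries ℤ_[ℓ]), omegaIw ℓ (n + 1) = ν * omegaIw ℓ n := by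
  refine ⟨∑ i ∈ Finset.range ℓ, ((1 + PowerSeries.X) ^ ℓ ^ n) ^ i, ?_, ?_⟩
  · rw [IsLocalRing.mem_maximalIdeal, mem_nonunits_iff, PowerSeries.isUnit_iff_constantCoeff]
    simpa using PadicInt.prime_p.not_isUnit
  · simp only [omegaIw]
    rw [geom_sum_mul, pow_succ, pow_mul]

theorem omegaIw_add_eq_mul (ℓ : ℕ) [Fact ℓ.Prime] (n k : ℕ) :
    ∃ ν ∈ IsLocalRing.maximalIdeal (PowerSeries ℤ_[ℓ]) ^ k,
      omegaIw ℓ (n + k) = ν * omegaIw ℓ n := by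
  induction k with
  | zero => exact ⟨1, by simp, by simp⟩
  | succ k ih =>
    obtain ⟨ν, hν, h⟩ := ih
    obtain ⟨μ, hμ, h'⟩ := omegaIw_succ_eq_mul ℓ (n + k)
    exact ⟨μ * ν, by rw [pow_succ']; exact Ideal.mul_mem_mul hμ hν,
      by rw [← add_assoc, h', h, mul_assoc]⟩

/-- For a submodule `T`, the submodules `{x | ω_n x ∈ T}` are eventually constant. -/
theorem exists_forall_omegaIw_smul_mem (ℓ : ℕ) [Fact ℓ.Prime]
    (X : Type*) [AddCommGroup X] [Module (PowerSeries ℤ_[ℓ]) X]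
    [Module.Finite (PowerSeries ℤ_[ℓ]) X] (T : Submodule (PowerSeries ℤ_[ℓ]) X) :
    ∃ m, ∀ n, m ≤ n → ∀ x : X, omegaIw ℓ n • x ∈ T → omegaIw ℓ m • x ∈ T := by
  let f : ℕ →o Submodule (PowerSeries ℤ_[ℓ]) X :=
    { toFun n := T.comap (LinearMap.lsmul (PowerSeries ℤ_[ℓ]) X (omegaIw ℓ n))
      monotone' := monotone_nat_of_le_succ fun n x hx ↦ by
        obtain ⟨ν, -, h⟩ := omegaIw_succ_eq_mul ℓ n
        simp only [Submodule.mem_comap, LinearMap.lsmul_apply] at hx ⊢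
        rw [h, mul_smul]
        exact T.smul_mem ν hx }
  obtain ⟨m, hm⟩ := monotone_stabilizes_iff_noetherian.mpr
    (isNoetherian_of_isNoetherianRing_of_finite (PowerSeries ℤ_[ℓ]) X) f
  exact ⟨m, fun n hn x hx ↦ (hm n hn).ge (show x ∈ f n from hx)⟩

theorem exists_forall_inf_omegaSub_eq_bot (ℓ : ℕ) [Fact ℓ.Prime]
    (X : Type*) [AddCommGroup X] [Module (PowerSeries ℤ_[ℓ]) X]
    [Module.Finite (PowerSeries ℤ_[ℓ]) X]
    (T : Submodule (PowerSeries ℤ_[ℓ]) X) (hTfin : (T : Set X).Finite) :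
    ∃ N : ℕ, ∀ n, N ≤ n → T ⊓ omegaSub ℓ n X = ⊥ := by
  have : Finite T := hTfin
  obtain ⟨k, hk⟩ :=
    exists_maximalIdeal_pow_le_annihilator_of_finite (R := PowerSeries ℤ_[ℓ]) (M := T)
  obtain ⟨m, hm⟩ := exists_forall_omegaIw_smul_mem ℓ X T
  refine ⟨m + k, fun n hn ↦ (Submodule.eq_bot_iff _).mpr ?_⟩
  rintro _ ⟨hxT, x, rfl⟩
  obtain ⟨j, rfl⟩ := Nat.exists_eq_add_of_le ((Nat.le_add_right m k).trans hn)
  obtain ⟨ν, hν, h⟩ := omegaIw_add_eq_mul ℓ m j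
  have hν' := hk (Ideal.pow_le_pow_right (by lia) hν)
  rw [LinearMap.lsmul_apply] at hxT ⊢
  rw [h, mul_smul]
  exact congrArg Subtype.val
    (Module.mem_annihilator.mp hν' ⟨omegaIw ℓ m • x, hm _ (Nat.le_add_right m j) x hxT⟩)

/-- Let `X` be a finitely generated module over `Λ = ℤ_ℓ[[X]]` and `T` its
largest finite `Λ`-submodule.  Then for all large `n`, `T ∩ ω_n X = 0`; consequently the
natural map `T → (T + ω_n X)/ω_n X` (restriction of the projection `X → X/ω_n X`) is
injective with image `(T + ω_n X)/ω_n X`, hence an isomorphism, so the capitulation kernels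
`(T + ω_n X)/ω_n X` are ultimately all isomorphic to `T`. -/
theorem largest_finite_submodule_meets_omega_trivially
    (ℓ : ℕ) [Fact ℓ.Prime]
    (X : Type*) [AddCommGroup X] [Module (PowerSeries ℤ_[ℓ]) X]
    [Module.Finite (PowerSeries ℤ_[ℓ]) X]
    (T : Submodule (PowerSeries ℤ_[ℓ]) X) (hTfin : (T : Set X).Finite)
    (hTmax : ∀ S : Submodule (PowerSeries ℤ_[ℓ]) X, (S : Set X).Finite → S ≤ T) :
    ∃ N : ℕ, ∀ n, N ≤ n →
      T ⊓ omegaSub ℓ n X = ⊥ ∧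
      Function.Injective ⇑((omegaSub ℓ n X).mkQ.comp T.subtype) ∧
      LinearMap.range ((omegaSub ℓ n X).mkQ.comp T.subtype)
        = Submodule.map (omegaSub ℓ n X).mkQ (T ⊔ omegaSub ℓ n X) := by
  obtain ⟨N, hN⟩ := exists_forall_inf_omegaSub_eq_bot ℓ X T hTfin
  refine ⟨N, fun n hn ↦ ⟨hN n hn, ?_, ?_⟩⟩
  · rw [← LinearMap.ker_eq_bot, LinearMap.ker_comp, Submodule.ker_mkQ,
      ← Submodule.disjoint_iff_comap_eq_bot]
    exact disjoint_iff.mpr (hN n hn)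
  · rw [LinearMap.range_comp, Submodule.range_subtype, Submodule.map_sup,
      Submodule.mkQ_map_self, sup_bot_eq]
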